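/- Let v = (v₁,v₂) ∈ C₀^∞(P;ℝ²) and f ∈ C₀^∞(P;[0,∞)) with f > |v| on supp v. Then: (i) p[v,f] = p[−v,f]; (ii) if moreover v₂(·,x₂) is odd and v₁(·,x₂), f(·,x₂) are even for each fixed x₂ > 0, then p[v,f] is even, i.e. p[v,f](x) = p[v,f](−x) for all x ∈ ℝ²; (iii) if ṽ ∈ C₀^∞(P;ℝ²) and f̃ ∈ C₀^∞(P;[0,∞)) is another pair with f̃ > |ṽ| on supp ṽ and such that supp f and supp f̃ are disjoint, then p[v+ṽ, f+f̃] = p[v,f] + p[ṽ,f̃]. -/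

import Mathlib

noncomputable section

open MeasureTheory Real Set Filter Topology

abbrev E3 : Type := EuclideanSpace ℝ (Fin 3)

/-- The point of `ℝ³` with coordinates `(a, b, c)`. -/
def e3 (a b c : ℝ) : E3 := (EuclideanSpace.equiv (Fin 3) ℝ).symm ![a, b, c]

/-- Spatial partial derivative `∂ᵢ w`. -/
def pd3 (w : E3 → ℝ) (i : Fin 3) (x : E3) : ℝ := fderiv ℝ w x (EuclideanSpace.single i 1)

/-- Laplacian of a scalar function on `ℝ³`. -/
def lap3 (w : E3 → ℝ) (x : E3) : ℝ := ∑ i : Fin 3, pd3 (fun y => pd3 w i y) i x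

/-- Divergence of a vector field on `ℝ³`. -/
def div3 (u : E3 → E3) (x : E3) : ℝ := ∑ i : Fin 3, pd3 (fun y => u y i) i x

/-- `|∇u|²`. -/
def gradsq (u : E3 → E3) (x : E3) : ℝ :=
  ∑ i : Fin 3, ∑ j : Fin 3, (pd3 (fun y => u y j) i x) ^ 2

/-- The pressure function corresponding to a vector field `u`. -/
def pressureFn (u : E3 → E3) (x : E3) : ℝ :=
  ∫ y : E3, (∑ i : Fin 3, ∑ j : Fin 3,
    pd3 (fun z => u z j) i y * pd3 (fun z => u z i) j y) / (4 * π * ‖x - y‖)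

/-- Rotation about the `x₁` axis by angle `θ`. -/
def rot3 (θ : ℝ) (x : E3) : E3 :=
  e3 (x 0) (x 1 * Real.cos θ - x 2 * Real.sin θ) (x 1 * Real.sin θ + x 2 * Real.cos θ)

abbrev Pt : Type := ℝ × ℝ

/-- The open upper half-plane `P`. -/
def Pset : Set Pt := {p | 0 < p.2}

def pdx (g : Pt → ℝ) (p : Pt) : ℝ := fderiv ℝ g p (1, 0)

def pdy (g : Pt → ℝ) (p : Pt) : ℝ := fderiv ℝ g p (0, 1)

/-- The operator `L`, `Lg = Δg + ∂₂ g / x₂ - g / x₂²`. -/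
def Lop (g : Pt → ℝ) (p : Pt) : ℝ :=
  (pdx (fun q => pdx g q) p + pdy (fun q => pdy g q) p) + pdy g p / p.2 - g p / p.2 ^ 2

/-- `div (x₂ v(x₁,x₂))` for a planar vector field `v = (w₁, w₂)`. -/
def div2w (w₁ w₂ : Pt → ℝ) (p : Pt) : ℝ :=
  pdx (fun q => q.2 * w₁ q) p + pdy (fun q => q.2 * w₂ q) p

/-- `g ∈ C₀^∞(P)`. -/
def SmoothCompSuppP (g : Pt → ℝ) : Prop :=
  ContDiff ℝ (⊤ : ℕ∞) g ∧ HasCompactSupport g ∧ tsupport g ⊆ Pset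

/-- Distance to the `x₁`-axis. -/
def rad (x : E3) : ℝ := Real.sqrt ((x 1) ^ 2 + (x 2) ^ 2)

/-- The cylindrical projection `R⁻¹`. -/
def Rinv (x : E3) : Pt := (x 0, rad x)

/-- The rotation `R(V)` of a subset `V` of the (closed) upper half-plane. -/
def Rset (V : Set Pt) : Set E3 := {x | Rinv x ∈ V}

def wcomp (v₁ v₂ f : Pt → ℝ) (p : Pt) : ℝ := Real.sqrt (f p ^ 2 - (v₁ p ^ 2 + v₂ p ^ 2))

/-- The axisymmetric vector field `u[v,f]` determined (in cylindrical coordinates) by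
`u[v,f](x₁,x₂,0) = (v₁(x₁,x₂), v₂(x₁,x₂), √(f(x₁,x₂)² − |v(x₁,x₂)|²))` for `x₂ ≥ 0`. -/
def uvf (v₁ v₂ f : Pt → ℝ) (x : E3) : E3 :=
  e3 (v₁ (Rinv x))
    (v₂ (Rinv x) * (x 1 / rad x) - wcomp v₁ v₂ f (Rinv x) * (x 2 / rad x))
    (v₂ (Rinv x) * (x 2 / rad x) + wcomp v₁ v₂ f (Rinv x) * (x 1 / rad x))

/-- The planar pressure function `p[v,f]`, the restriction to `{x₃ = 0}` of the pressure
function `p*[v,f]` corresponding to `u[v,f]`. -/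
def pvf (v₁ v₂ f : Pt → ℝ) (q : Pt) : ℝ := pressureFn (uvf v₁ v₂ f) (e3 q.1 q.2 0)

def zf : Pt → ℝ := fun _ => 0

/-- First component of the pressure interaction function `F[v,f] = ∇p[0,f] − ∇p[v,f]`. -/
def Fpi1 (v₁ v₂ f : Pt → ℝ) (q : Pt) : ℝ := pdx (pvf zf zf f) q - pdx (pvf v₁ v₂ f) q

/-- Second component of the pressure interaction function `F[v,f] = ∇p[0,f] − ∇p[v,f]`. -/
def Fpi2 (v₁ v₂ f : Pt → ℝ) (q : Pt) : ℝ := pdy (pvf zf zf f) q - pdy (pvf v₁ v₂ f) q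

/-- A structure `(v, f, φ)` (with `v = (w₁,w₂)`) on a set `U ⋐ P`. -/
structure StructureOn (U : Set Pt) (w₁ w₂ f φ : Pt → ℝ) : Prop where
  smooth_w₁ : ContDiff ℝ (⊤ : ℕ∞) w₁
  smooth_w₂ : ContDiff ℝ (⊤ : ℕ∞) w₂
  smooth_f : ContDiff ℝ (⊤ : ℕ∞) f
  smooth_phi : ContDiff ℝ (⊤ : ℕ∞) φ
  hcs_w₁ : HasCompactSupport w₁
  hcs_w₂ : HasCompactSupport w₂
  hcs_f : HasCompactSupport f
  hcs_phi : HasCompactSupport φ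
  supp_w₁ : tsupport w₁ ⊆ {p | φ p = 1}
  supp_w₂ : tsupport w₂ ⊆ {p | φ p = 1}
  supp_f : tsupport f = closure U
  f_nonneg : ∀ p, 0 ≤ f p
  phi_mem : ∀ p, φ p ∈ Icc (0:ℝ) 1
  supp_phi : tsupport φ ⊆ U
  div_v : ∀ p ∈ U, div2w w₁ w₂ p = 0
  f_gt : ∀ p ∈ U, Real.sqrt (w₁ p ^ 2 + w₂ p ^ 2) < f p
  Lf_pos : ∀ p ∈ U, φ p ≠ 1 → 0 < Lop f p

/-- `u` is a weak solution of the Navier–Stokes inequality with viscosity `ν`: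
the local energy inequality holds against every nonnegative test function
`φ ∈ C₀^∞(ℝ³ × (0,∞))`. -/
def IsWeakNSI (ν : ℝ) (u : E3 → ℝ → E3) : Prop :=
  ∀ φ : E3 × ℝ → ℝ, ContDiff ℝ (⊤ : ℕ∞) φ → HasCompactSupport φ →
    tsupport φ ⊆ {z : E3 × ℝ | 0 < z.2} → (∀ z, 0 ≤ φ z) →
    2 * ν * (∫ t in Ioi (0:ℝ), ∫ x : E3, gradsq (fun y => u y t) x * φ (x, t)) ≤
      ∫ t in Ioi (0:ℝ), ∫ x : E3,
        (‖u x t‖ ^ 2 * (deriv (fun s => φ (x, s)) t + ν * lap3 (fun y => φ (y, t)) x)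
          + (‖u x t‖ ^ 2 + 2 * pressureFn (fun y => u y t) x) *
              (∑ i : Fin 3, u x t i * pd3 (fun y => φ (y, t)) i x))

/-- The regularity `sup_{t>0} ‖u(t)‖_{L²} < ∞` and `∇u ∈ L²(ℝ³ × (0,∞))`. -/
def NSIRegular (u : E3 → ℝ → E3) : Prop :=
  (∃ M : ℝ, ∀ t, 0 < t →
    Integrable (fun x : E3 => ‖u x t‖ ^ 2) ∧ (∫ x : E3, ‖u x t‖ ^ 2) ≤ M) ∧
  IntegrableOn (fun z : E3 × ℝ => gradsq (fun y => u y z.2) z.1) (univ ×ˢ Ioi 0)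

/-- `u` is unbounded in every neighbourhood of `(x₀, T₀)`. -/
def UnboundedNear (u : E3 → ℝ → E3) (x₀ : E3) (T₀ : ℝ) : Prop :=
  ∀ ε > 0, ∀ M : ℝ, ∃ x : E3, ∃ t : ℝ, 0 < t ∧ ‖x - x₀‖ < ε ∧ |t - T₀| < ε ∧ M < ‖u x t‖

/-- The singular set of `u`. -/
def SingularSet (u : E3 → ℝ → E3) : Set (E3 × ℝ) :=
  {z | 0 < z.2 ∧ UnboundedNear u z.1 z.2}

/-- `u · (∂_t u + (u·∇)u + ∇p)`, where `p` is the pressure corresponding to `u(·,t)`. -/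
def eulerOp (u : E3 → ℝ → E3) (x : E3) (t : ℝ) : ℝ :=
  ∑ j : Fin 3, u x t j *
    (deriv (fun s => u x s j) t
      + (∑ i : Fin 3, u x t i * pd3 (fun y => u y t j) i x)
      + pd3 (pressureFn (fun y => u y t)) j x)

/-- `u · (∂_t u − νΔu + (u·∇)u + ∇p)`, where `p` is the pressure corresponding to `u(·,t)`. -/
def nsOp (ν : ℝ) (u : E3 → ℝ → E3) (x : E3) (t : ℝ) : ℝ :=
  ∑ j : Fin 3, u x t j *
    (deriv (fun s => u x s j) t - ν * lap3 (fun y => u y t j) x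
      + (∑ i : Fin 3, u x t i * pd3 (fun y => u y t j) i x)
      + pd3 (pressureFn (fun y => u y t)) j x)

/-- The time-dependent modification `h_{1,t}` of `f₁`. -/
def h1d (f₁ φ₁ : Pt → ℝ) (δ t : ℝ) (p : Pt) : ℝ :=
  Real.sqrt (f₁ p ^ 2 - 2 * t * δ * φ₁ p)

/-- The time-dependent modification `h_{2,t}` of `f₂`. -/
def h2d (w₁ w₂ f₁ φ₁ b₁ b₂ f₂ φ₂ : Pt → ℝ) (δ t : ℝ) (p : Pt) : ℝ :=
  Real.sqrt (f₂ p ^ 2 - 2 * t * δ * φ₂ p +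
    ∫ s in (0:ℝ)..t,
      (b₁ p * Fpi1 w₁ w₂ (h1d f₁ φ₁ δ s) p + b₂ p * Fpi2 w₁ w₂ (h1d f₁ φ₁ δ s) p))

/-- The constant `D` of Lemma 3.4 (i). -/
def Dconst (w₁ : Pt → ℝ) : ℝ := (9 / (4 * π)) * ∫ y : E3, (w₁ (Rinv y)) ^ 2

/-- A (planar, open) rectangle. -/
def IsRect (V : Set Pt) : Prop :=
  ∃ a₁ b₁ a₂ b₂ : ℝ, a₁ < b₁ ∧ a₂ < b₂ ∧ V = Ioo a₁ b₁ ×ˢ Ioo a₂ b₂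

/-- The isometry of `ℝ³` changing the sign of the coordinates in `s`. -/
def coordFlip (s : Finset (Fin 3)) : E3 ≃ₗᵢ[ℝ] E3 :=
  LinearIsometryEquiv.piLpCongrRight 2 fun i =>
    if i ∈ s then LinearIsometryEquiv.neg ℝ else LinearIsometryEquiv.refl ℝ ℝ

/-- The sign by which `coordFlip s` multiplies the `i`-th coordinate. -/
def coordSign (s : Finset (Fin 3)) (i : Fin 3) : ℝ := if i ∈ s then -1 else 1

lemma coordSign_sq (s : Finset (Fin 3)) (i : Fin 3) : coordSign s i ^ 2 = 1 := by
  unfold coordSign; split_ifs <;> norm_num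

lemma coordFlip_apply (s : Finset (Fin 3)) (x : E3) (i : Fin 3) :
    coordFlip s x i = coordSign s i * x i := by
  simp only [coordFlip, coordSign, LinearIsometryEquiv.piLpCongrRight_apply]
  split_ifs <;> simp

lemma coordFlip_single (s : Finset (Fin 3)) (i : Fin 3) :
    coordFlip s (EuclideanSpace.single i 1) = coordSign s i • EuclideanSpace.single i (1 : ℝ) := by
  ext j
  rw [coordFlip_apply]
  by_cases h : j = i
  · subst h; simp
  · simp [h]

/-- The source `∑ ∂ᵢuⱼ ∂ⱼuᵢ` of the pressure corresponding to `u`. -/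
def pressureSource (u : E3 → E3) (y : E3) : ℝ :=
  ∑ i : Fin 3, ∑ j : Fin 3, pd3 (fun z => u z j) i y * pd3 (fun z => u z i) j y

lemma pd3_smul_comp_coordFlip (s : Finset (Fin 3)) (c : ℝ) (w : E3 → ℝ) (i : Fin 3) (y : E3) :
    pd3 (fun z => c * w (coordFlip s z)) i y = c * coordSign s i * pd3 w i (coordFlip s y) := by
  have h : (fun z => c * w (coordFlip s z)) =
      c • (w ∘ (coordFlip s).toContinuousLinearEquiv) := rfl
  rw [pd3, h, fderiv_const_smul_field, Pi.smul_apply, ContinuousLinearEquiv.comp_right_fderiv]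
  simp [coordFlip_single, pd3, mul_assoc]

lemma pressureSource_comp_coordFlip {u u' : E3 → E3} (s : Finset (Fin 3)) {c : ℝ}
    (hc : c ^ 2 = 1) (h : ∀ x i, u' x i = c * coordSign s i * u (coordFlip s x) i) (y : E3) :
    pressureSource u' y = pressureSource u (coordFlip s y) := by
  unfold pressureSource
  refine Finset.sum_congr rfl fun i _ => Finset.sum_congr rfl fun j _ => ?_
  simp only [h]
  rw [pd3_smul_comp_coordFlip s _ (fun z => u z j), pd3_smul_comp_coordFlip s _ (fun z => u z i)]
  linear_combination
    (pd3 (fun z => u z j) i (coordFlip s y) * pd3 (fun z => u z i) j (coordFlip s y)) *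
      (c ^ 2 * coordSign s i ^ 2 * coordSign_sq s j + c ^ 2 * coordSign_sq s i + hc)

lemma pressureFn_comp_coordFlip {u u' : E3 → E3} (s : Finset (Fin 3)) {c : ℝ}
    (hc : c ^ 2 = 1) (h : ∀ x i, u' x i = c * coordSign s i * u (coordFlip s x) i) (x : E3) :
    pressureFn u' x = pressureFn u (coordFlip s x) := by
  have hmp := (coordFlip s).measurePreserving.integral_comp
    (coordFlip s).toHomeomorph.measurableEmbedding
    (fun y => pressureSource u y / (4 * π * ‖coordFlip s x - y‖))
  change ∫ y, pressureSource u' y / (4 * π * ‖x - y‖) =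
    ∫ y, pressureSource u y / (4 * π * ‖coordFlip s x - y‖)
  rw [← hmp]
  refine integral_congr_ae (Eventually.of_forall fun y => ?_)
  simp only [pressureSource_comp_coordFlip s hc h y, ← map_sub, LinearIsometryEquiv.norm_map]

lemma rad_coordFlip (s : Finset (Fin 3)) (x : E3) : rad (coordFlip s x) = rad x := by
  simp [rad, coordFlip_apply, mul_pow, coordSign_sq]

lemma pvf_neg (v₁ v₂ f : Pt → ℝ) (q : Pt) :
    pvf v₁ v₂ f q = pvf (fun p => -v₁ p) (fun p => -v₂ p) f q := by
  have hq : coordFlip {2} (e3 q.1 q.2 0) = e3 q.1 q.2 0 := by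
    ext i; rw [coordFlip_apply]; fin_cases i <;> simp [coordSign, e3]
  unfold pvf
  conv_lhs => rw [← hq]
  refine (pressureFn_comp_coordFlip {2} (c := -1) (by norm_num) (fun x i => ?_) _).symm
  fin_cases i <;>
    simp [uvf, e3, rad_coordFlip, coordFlip_apply, coordSign, wcomp, Rinv] <;> ring

lemma pvf_even {v₁ v₂ f : Pt → ℝ} (h₂ : ∀ x₁ x₂ : ℝ, v₂ (-x₁, x₂) = -v₂ (x₁, x₂))
    (h₁ : ∀ x₁ x₂ : ℝ, v₁ (-x₁, x₂) = v₁ (x₁, x₂)) (hf : ∀ x₁ x₂ : ℝ, f (-x₁, x₂) = f (x₁, x₂))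
    (q : Pt) : pvf v₁ v₂ f q = pvf v₁ v₂ f (-q) := by
  have hq : coordFlip {0, 1} (e3 q.1 q.2 0) = e3 (-q).1 (-q).2 0 := by
    ext i; rw [coordFlip_apply]; fin_cases i <;> simp [coordSign, e3]
  unfold pvf
  rw [← hq]
  refine pressureFn_comp_coordFlip {0, 1} (c := -1) (by norm_num) (fun x i => ?_) _
  fin_cases i <;>
    simp [uvf, e3, rad_coordFlip, coordFlip_apply, coordSign, wcomp, Rinv,
      h₁, h₂, hf] <;> ring

lemma continuous_rad : Continuous rad := by unfold rad; fun_prop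

lemma continuous_Rinv : Continuous Rinv := by unfold Rinv; have := continuous_rad; fun_prop

lemma norm_sq_eq_Rinv (x : E3) : ‖x‖ ^ 2 = (Rinv x).1 ^ 2 + (Rinv x).2 ^ 2 := by
  rw [EuclideanSpace.real_norm_sq_eq, Fin.sum_univ_three]
  simp only [Rinv, rad]
  rw [Real.sq_sqrt (by positivity)]
  ring

lemma isCompact_Rinv_preimage {K : Set Pt} (hK : IsCompact K) : IsCompact (Rinv ⁻¹' K) := by
  obtain ⟨C, hC⟩ := hK.isBounded.exists_norm_le
  refine Metric.isCompact_of_isClosed_isBounded (hK.isClosed.preimage continuous_Rinv)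
    (isBounded_iff_forall_norm_le.2 ⟨2 * C, fun x hx => ?_⟩)
  have hx' := hC _ hx
  have h0 : 0 ≤ C := (norm_nonneg _).trans hx'
  have h1 := sq_le_sq.2 (((norm_fst_le _).trans hx').trans (le_abs_self C))
  have h2 := sq_le_sq.2 (((norm_snd_le _).trans hx').trans (le_abs_self C))
  have := norm_sq_eq_Rinv x
  exact abs_le_of_sq_le_sq' (by nlinarith) (by linarith) |>.2

/-- The hypotheses under which `u[v,f]` is a smooth, compactly supported vector field. -/
structure AdmissibleProfile (v₁ v₂ f : Pt → ℝ) : Prop where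
  smooth_v₁ : SmoothCompSuppP v₁
  smooth_v₂ : SmoothCompSuppP v₂
  smooth_f : SmoothCompSuppP f
  f_nonneg : ∀ p, 0 ≤ f p
  f_gt : ∀ p ∈ tsupport v₁ ∪ tsupport v₂, Real.sqrt (v₁ p ^ 2 + v₂ p ^ 2) < f p

namespace AdmissibleProfile

variable {v₁ v₂ f : Pt → ℝ}

lemma tsupport_subset (h : AdmissibleProfile v₁ v₂ f) :
    tsupport v₁ ∪ tsupport v₂ ⊆ tsupport f := fun p hp =>
  subset_tsupport f ((Real.sqrt_nonneg _).trans_lt (h.f_gt p hp)).ne'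

lemma eventuallyEq_zero (h : AdmissibleProfile v₁ v₂ f) {p : Pt} (hp : p ∉ tsupport f) :
    ∀ᶠ q in 𝓝 p, v₁ q = 0 ∧ v₂ q = 0 ∧ f q = 0 := by
  have h₁ := notMem_tsupport_iff_eventuallyEq.1 fun hv => hp (h.tsupport_subset (Or.inl hv))
  have h₂ := notMem_tsupport_iff_eventuallyEq.1 fun hv => hp (h.tsupport_subset (Or.inr hv))
  filter_upwards [h₁, h₂, notMem_tsupport_iff_eventuallyEq.1 hp] with q a b c
  exact ⟨a, b, c⟩

lemma contDiff_wcomp (h : AdmissibleProfile v₁ v₂ f) : ContDiff ℝ (⊤ : ℕ∞) (wcomp v₁ v₂ f) := by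
  refine contDiff_iff_contDiffAt.2 fun p => ?_
  have hv₁ := h.smooth_v₁.1
  have hv₂ := h.smooth_v₂.1
  have hf := h.smooth_f.1
  by_cases hp : p ∈ tsupport v₁ ∪ tsupport v₂
  · refine ContDiffAt.sqrt (by fun_prop) (sub_pos.2 ?_).ne'
    exact (Real.sqrt_lt' ((Real.sqrt_nonneg _).trans_lt (h.f_gt p hp))).1 (h.f_gt p hp)
  · rw [mem_union, not_or] at hp
    refine hf.contDiffAt.congr_of_eventuallyEq ?_
    filter_upwards [notMem_tsupport_iff_eventuallyEq.1 hp.1,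
      notMem_tsupport_iff_eventuallyEq.1 hp.2] with q a b
    simp [wcomp, a, b, Real.sqrt_sq (h.f_nonneg q)]

lemma uvf_eventuallyEq_zero (h : AdmissibleProfile v₁ v₂ f) {x : E3}
    (hx : Rinv x ∉ tsupport f) : uvf v₁ v₂ f =ᶠ[𝓝 x] 0 := by
  filter_upwards [continuous_Rinv.continuousAt.eventually (h.eventuallyEq_zero hx)] with y hy
  ext i
  fin_cases i <;> simp [uvf, e3, wcomp, hy]

lemma contDiff_uvf (h : AdmissibleProfile v₁ v₂ f) : ContDiff ℝ (⊤ : ℕ∞) (uvf v₁ v₂ f) := by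
  refine contDiff_iff_contDiffAt.2 fun x => ?_
  by_cases hx : Rinv x ∈ tsupport f
  · have hpos : 0 < rad x := h.smooth_f.2.2 hx
    have hrad : ContDiffAt ℝ (⊤ : ℕ∞) rad x :=
      ContDiffAt.sqrt (by fun_prop) (Real.sqrt_pos.1 hpos).ne'
    have hR : ContDiffAt ℝ (⊤ : ℕ∞) Rinv x := by
      unfold Rinv
      fun_prop
    have hv₁ := h.smooth_v₁.1.contDiffAt.comp x hR
    have hv₂ := h.smooth_v₂.1.contDiffAt.comp x hR
    have hw := h.contDiff_wcomp.contDiffAt.comp x hR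
    have h1 : ContDiffAt ℝ (⊤ : ℕ∞) (fun y : E3 => y 1 / rad y) x :=
      ContDiffAt.div (by fun_prop) hrad hpos.ne'
    have h2 : ContDiffAt ℝ (⊤ : ℕ∞) (fun y : E3 => y 2 / rad y) x :=
      ContDiffAt.div (by fun_prop) hrad hpos.ne'
    refine contDiffAt_euclidean.2 fun i => ?_
    fin_cases i
    · simpa [uvf, e3, Function.comp_def] using hv₁
    · simpa [uvf, e3, Function.comp_def] using (hv₂.mul h1).sub (hw.mul h2)
    · simpa [uvf, e3, Function.comp_def] using (hv₂.mul h2).add (hw.mul h1)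
  · exact contDiffAt_const.congr_of_eventuallyEq (h.uvf_eventuallyEq_zero hx)

end AdmissibleProfile

lemma pressureSource_congr {u u' : E3 → E3} {x : E3} (h : u =ᶠ[𝓝 x] u') :
    pressureSource u x = pressureSource u' x := by
  have hc (j : Fin 3) : fderiv ℝ (fun z => u z j) x = fderiv ℝ (fun z => u' z j) x :=
    Filter.EventuallyEq.fderiv_eq (h.fun_comp fun v : E3 => v j)
  simp only [pressureSource, pd3, hc]

lemma pressureSource_zero (x : E3) : pressureSource 0 x = 0 := by
  simp [pressureSource, pd3]

lemma continuous_pressureSource {u : E3 → E3} (hu : ContDiff ℝ (⊤ : ℕ∞) u) :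
    Continuous (pressureSource u) := by
  have hc (i j : Fin 3) : Continuous (pd3 (fun z => u z j) i) :=
    ((contDiff_euclidean.1 hu j).continuous_fderiv (by simp)).clm_apply continuous_const
  unfold pressureSource
  fun_prop

lemma integrable_pressure {g : E3 → ℝ} (hg : Continuous g) (hc : HasCompactSupport g) (x : E3) :
    Integrable fun y => g y / (4 * π * ‖x - y‖) := by
  have hloc : LocallyIntegrable (fun z : E3 => (4 * π * ‖z‖)⁻¹) := by
    refine locallyIntegrable_of_norm_le_rpow (C := (4 * π)⁻¹) (α := 1) (by simp) (by norm_num)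
      (Eventually.of_forall fun z => ?_) (by fun_prop)
    rw [Real.norm_of_nonneg (by positivity), mul_inv, Real.rpow_neg_one]
  have hint := hloc.integrable_smul_left_of_hasCompactSupport
    (hg.comp (continuous_const.sub continuous_id : Continuous fun z => x - z))
    (hc.comp_homeomorph (Homeomorph.subLeft x))
  simpa [div_eq_mul_inv] using hint.comp_sub_left x

lemma AdmissibleProfile.integrable {v₁ v₂ f : Pt → ℝ} (h : AdmissibleProfile v₁ v₂ f) (x : E3) :
    Integrable fun y => pressureSource (uvf v₁ v₂ f) y / (4 * π * ‖x - y‖) := by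
  refine integrable_pressure (continuous_pressureSource h.contDiff_uvf)
    (HasCompactSupport.intro (isCompact_Rinv_preimage h.smooth_f.2.1) fun y hy => ?_) x
  rw [pressureSource_congr (h.uvf_eventuallyEq_zero hy), pressureSource_zero]

lemma pvf_add {v₁ v₂ f v₁' v₂' f' : Pt → ℝ} (h : AdmissibleProfile v₁ v₂ f)
    (h' : AdmissibleProfile v₁' v₂' f') (hd : Disjoint (tsupport f) (tsupport f')) (q : Pt) :
    pvf (fun p => v₁ p + v₁' p) (fun p => v₂ p + v₂' p) (fun p => f p + f' p) q =
      pvf v₁ v₂ f q + pvf v₁' v₂' f' q := by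
  refine (integral_congr_ae (Eventually.of_forall fun y => ?_)).trans
    (integral_add (h.integrable _) (h'.integrable _))
  rw [← add_div]
  congr 1
  change pressureSource _ y = pressureSource (uvf v₁ v₂ f) y + pressureSource (uvf v₁' v₂' f') y
  by_cases hy : Rinv y ∈ tsupport f
  · have hy' := disjoint_left.1 hd hy
    rw [pressureSource_congr (h'.uvf_eventuallyEq_zero hy'), pressureSource_zero, add_zero]
    refine pressureSource_congr ?_
    filter_upwards [continuous_Rinv.continuousAt.eventually (h'.eventuallyEq_zero hy')] with z hz
    simp [uvf, wcomp, hz]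
  · rw [pressureSource_congr (h.uvf_eventuallyEq_zero hy), pressureSource_zero, zero_add]
    refine pressureSource_congr ?_
    filter_upwards [continuous_Rinv.continuousAt.eventually (h.eventuallyEq_zero hy)] with z hz
    simp [uvf, wcomp, hz]

/-- Lemma 2.2: properties of `p[v,f]`. -/
theorem statement_7 (v₁ v₂ f : Pt → ℝ)
    (hv₁ : SmoothCompSuppP v₁) (hv₂ : SmoothCompSuppP v₂)
    (hf : SmoothCompSuppP f) (hf0 : ∀ p, 0 ≤ f p)
    (hfv : ∀ p ∈ tsupport v₁ ∪ tsupport v₂, Real.sqrt (v₁ p ^ 2 + v₂ p ^ 2) < f p) :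
    (∀ q : Pt, pvf v₁ v₂ f q = pvf (fun p => -v₁ p) (fun p => -v₂ p) f q) ∧
    ((∀ x₁ x₂ : ℝ, v₂ (-x₁, x₂) = -v₂ (x₁, x₂)) →
      (∀ x₁ x₂ : ℝ, v₁ (-x₁, x₂) = v₁ (x₁, x₂)) →
      (∀ x₁ x₂ : ℝ, f (-x₁, x₂) = f (x₁, x₂)) →
      ∀ q : Pt, pvf v₁ v₂ f q = pvf v₁ v₂ f (-q)) ∧
    (∀ v₁' v₂' f' : Pt → ℝ,
      SmoothCompSuppP v₁' → SmoothCompSuppP v₂' → SmoothCompSuppP f' →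
      (∀ p, 0 ≤ f' p) →
      (∀ p ∈ tsupport v₁' ∪ tsupport v₂', Real.sqrt (v₁' p ^ 2 + v₂' p ^ 2) < f' p) →
      Disjoint (tsupport f) (tsupport f') →
      ∀ q : Pt,
        pvf (fun p => v₁ p + v₁' p) (fun p => v₂ p + v₂' p) (fun p => f p + f' p) q =
          pvf v₁ v₂ f q + pvf v₁' v₂' f' q) := by
  have h : AdmissibleProfile v₁ v₂ f := ⟨hv₁, hv₂, hf, hf0, hfv⟩
  exact ⟨pvf_neg v₁ v₂ f, fun h₂ h₁ hfe => pvf_even h₂ h₁ hfe,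
    fun _ _ _ h₁ h₂ hf' hf0' hfv' hd => pvf_add h ⟨h₁, h₂, hf', hf0', hfv'⟩ hd⟩
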